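/- Let X be a quasi-median graph. Then there exist a simplicial tree T and a (91,182)-quasi-isometry from T to the contact graph CX; in particular, CX is a quasi-tree. -/

import Mathlib

namespace QM

variable {V : Type*}

/-- `y₁` and `y₂` lie (in this order) on a common geodesic from `x₁` to `x₂`. -/
def OnGeod (X : SimpleGraph V) (x₁ y₁ y₂ x₂ : V) : Prop :=
  X.dist x₁ y₁ + X.dist y₁ y₂ + X.dist y₂ x₂ = X.dist x₁ x₂

/-- `(y₁, y₂, y₃)` is a `k`-quasi-median triple for `(x₁, x₂, x₃)` (without minimality). -/
def IsQMTriple (X : SimpleGraph V) (x₁ x₂ x₃ y₁ y₂ y₃ : V) (k : ℕ) : Prop :=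
  OnGeod X x₁ y₁ y₂ x₂ ∧ OnGeod X x₁ y₁ y₃ x₃ ∧ OnGeod X x₂ y₂ y₃ x₃ ∧
    X.dist y₁ y₂ = k ∧ X.dist y₁ y₃ = k ∧ X.dist y₂ y₃ = k

/-- `y` is a quasi-median of the triple `(x₁, x₂, x₃)`: it is a `k`-quasi-median triple
with `k` as small as possible. -/
def IsQuasiMedianTriple (X : SimpleGraph V) (x₁ x₂ x₃ : V) (y : V × V × V) : Prop :=
  ∃ k : ℕ, IsQMTriple X x₁ x₂ x₃ y.1 y.2.1 y.2.2 k ∧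
    ∀ (k' : ℕ) (z₁ z₂ z₃ : V), IsQMTriple X x₁ x₂ x₃ z₁ z₂ z₃ k' → k ≤ k'

/-- The complete multipartite graph `K_{1,1,2}`: the complete graph on four vertices
with the edge between vertices `2` and `3` removed. -/
def K112 : SimpleGraph (Fin 4) :=
  SimpleGraph.fromRel (fun i j => ¬(i = 2 ∧ j = 3) ∧ ¬(i = 3 ∧ j = 2))

/-- The 1-skeleton of the 3-cube. -/
def cubeGraph : SimpleGraph (Fin 3 → Bool) :=
  SimpleGraph.fromRel (fun x y => ∃! i, x i ≠ y i)

/-- The 6-cycle. -/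
def C6 : SimpleGraph (Fin 6) := SimpleGraph.fromRel (fun i j => j = i + 1)

/-- A set of vertices is convex if it contains every vertex lying on a geodesic between
two of its members. -/
def IsConvexSet (X : SimpleGraph V) (S : Set V) : Prop :=
  ∀ x ∈ S, ∀ y ∈ S, ∀ z : V, X.dist x z + X.dist z y = X.dist x y → z ∈ S

/-- The convex hull of a set of vertices. -/
def convexHullSet (X : SimpleGraph V) (S : Set V) : Set V :=
  ⋂₀ {T : Set V | S ⊆ T ∧ IsConvexSet X T}

/-- A quasi-median graph: a connected graph in which every triple of vertices has a unique
quasi-median, with no induced `K_{1,1,2}`, and in which the convex hull of every isometrically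
embedded 6-cycle is isomorphic to the 3-cube. -/
structure IsQuasiMedian (X : SimpleGraph V) : Prop where
  connected : X.Connected
  uniqueQuasiMedian : ∀ x₁ x₂ x₃ : V, ∃! y : V × V × V, IsQuasiMedianTriple X x₁ x₂ x₃ y
  noK112 : IsEmpty (SimpleGraph.Embedding K112 X)
  hullOfC6IsCube : ∀ f : Fin 6 → V,
    (∀ i j, C6.Adj i j → X.Adj (f i) (f j)) →
    (∀ i j, X.dist (f i) (f j) = C6.dist i j) →
    Nonempty (SimpleGraph.Iso
      (SimpleGraph.induce (convexHullSet X (Set.range f)) X) cubeGraph)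

/-- Two edges are two sides of a common triangle, or opposite sides of a common square. -/
def SideRel (X : SimpleGraph V) (e f : Sym2 V) : Prop :=
  (∃ a b c : V, X.Adj a b ∧ X.Adj a c ∧ X.Adj b c ∧ e = s(a, b) ∧ f = s(a, c)) ∨
  (∃ a b c d : V, X.Adj a b ∧ X.Adj c d ∧ X.Adj a c ∧ X.Adj b d ∧ a ≠ d ∧ b ≠ c ∧
    e = s(a, b) ∧ f = s(c, d))

/-- The equivalence class of an edge under the equivalence relation generated by `SideRel`. -/
def hypClass (X : SimpleGraph V) (e : Sym2 V) : Set (Sym2 V) :=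
  {f | Relation.EqvGen (SideRel X) e f}

/-- A hyperplane: the equivalence class of some edge of `X`. -/
def IsHyperplane (X : SimpleGraph V) (H : Set (Sym2 V)) : Prop :=
  ∃ e ∈ X.edgeSet, H = hypClass X e

/-- The type of hyperplanes of `X`. -/
def Hyperplane (X : SimpleGraph V) := {H : Set (Sym2 V) // IsHyperplane X H}

/-- Edges `e`, `e'` sharing the endpoint `p`, not lying in a common clique, that are
adjacent sides of a square of `X`: their dual hyperplanes intersect at `p`. -/
def IntersectAt (X : SimpleGraph V) (e e' : Sym2 V) (p : V) : Prop :=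
  ∃ a b : V, e = s(p, a) ∧ e' = s(p, b) ∧ X.Adj p a ∧ X.Adj p b ∧ a ≠ b ∧ ¬ X.Adj a b ∧
    ∃ q : V, q ≠ p ∧ X.Adj a q ∧ X.Adj b q

/-- Edges `e`, `e'` sharing the endpoint `p`, not lying in a common clique, and not adjacent
sides of any square of `X`: their dual hyperplanes osculate at `p`. -/
def OsculateAt (X : SimpleGraph V) (e e' : Sym2 V) (p : V) : Prop :=
  ∃ a b : V, e = s(p, a) ∧ e' = s(p, b) ∧ X.Adj p a ∧ X.Adj p b ∧ a ≠ b ∧ ¬ X.Adj a b ∧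
    ¬ ∃ q : V, q ≠ p ∧ X.Adj a q ∧ X.Adj b q

/-- Hyperplanes `H` and `H'` intersect at `p`. -/
def HypIntersectAt (X : SimpleGraph V) (H H' : Hyperplane X) (p : V) : Prop :=
  ∃ e ∈ H.1, ∃ e' ∈ H'.1, IntersectAt X e e' p

/-- Hyperplanes `H` and `H'` osculate at `p`. -/
def HypOsculateAt (X : SimpleGraph V) (H H' : Hyperplane X) (p : V) : Prop :=
  ∃ e ∈ H.1, ∃ e' ∈ H'.1, OsculateAt X e e' p

/-- Hyperplanes `H` and `H'` intersect. -/
def HypIntersect (X : SimpleGraph V) (H H' : Hyperplane X) : Prop :=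
  ∃ p : V, HypIntersectAt X H H' p

/-- Hyperplanes `H` and `H'` osculate. -/
def HypOsculate (X : SimpleGraph V) (H H' : Hyperplane X) : Prop :=
  ∃ p : V, HypOsculateAt X H H' p

/-- The contact graph `𝒞X`: hyperplanes are adjacent iff they intersect or osculate. -/
def contactGraph (X : SimpleGraph V) : SimpleGraph (Hyperplane X) :=
  SimpleGraph.fromRel (fun H H' => HypIntersect X H H' ∨ HypOsculate X H H')

/-- The crossing graph `ΔX`: hyperplanes are adjacent iff they intersect. -/
def crossingGraph (X : SimpleGraph V) : SimpleGraph (Hyperplane X) :=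
  SimpleGraph.fromRel (fun H H' => HypIntersect X H H')

/-- The (vertex set of the) carrier of a hyperplane: all endpoints of its edges. -/
def hypCarrier (X : SimpleGraph V) (H : Hyperplane X) : Set V :=
  {v : V | ∃ e ∈ H.1, v ∈ e}

/-- A set of edges `H` (e.g. a hyperplane) separates `p` from `q` if every walk from `p`
to `q` uses an edge of `H`. -/
def Separates (X : SimpleGraph V) (H : Set (Sym2 V)) (p q : V) : Prop :=
  ∀ w : X.Walk p q, ∃ e ∈ w.edges, e ∈ H

/-- `f` is a `(λ, c)`-quasi-isometry from `(A, dA)` to `(B, dB)`. -/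
def IsQuasiIsometry {A B : Type*} (lam c : ℝ) (dA : A → A → ℝ) (dB : B → B → ℝ)
    (f : A → B) : Prop :=
  (∀ x y : A, dA x y / lam - c ≤ dB (f x) (f y) ∧ dB (f x) (f y) ≤ lam * dA x y + c) ∧
    ∀ b : B, ∃ a : A, dB (f a) b ≤ c

end QM

namespace QM

section Distance

variable {W : Type*} {G : SimpleGraph W}

lemma exists_adj_dist_eq (hG : G.Connected) {x y : W} {m : ℕ} (h : G.dist x y = m + 1) :
    ∃ z, G.Adj x z ∧ G.dist z y = m := by
  obtain ⟨p, hp⟩ := hG.exists_walk_length_eq_dist x y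
  cases p with
  | nil => simp at h
  | @cons _ z _ hadj q =>
    refine ⟨z, hadj, ?_⟩
    have h1 := SimpleGraph.dist_le q
    have h2 := hG.dist_triangle (u := x) (v := z) (w := y)
    have h3 := SimpleGraph.dist_eq_one_iff_adj.2 hadj
    simp only [SimpleGraph.Walk.length_cons] at hp
    omega

lemma dist_eq_two {x y z : W} (hne : x ≠ y) (hadj : ¬ G.Adj x y)
    (hxz : G.Adj x z) (hzy : G.Adj z y) : G.dist x y = 2 := by
  have hle := SimpleGraph.dist_le (hxz.toWalk.append hzy.toWalk)
  have hr : G.Reachable x y := ⟨hxz.toWalk.append hzy.toWalk⟩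
  have h0 : G.dist x y ≠ 0 := fun h => hne (hr.dist_eq_zero_iff.1 h)
  have h1 : G.dist x y ≠ 1 := fun h => hadj (SimpleGraph.dist_eq_one_iff_adj.1 h)
  simp at hle
  omega

lemma dist_eq_three {x y z t : W} (hne : x ≠ y) (hadj : ¬ G.Adj x y)
    (hcommon : ∀ s, ¬ (G.Adj x s ∧ G.Adj s y))
    (hxz : G.Adj x z) (hzt : G.Adj z t) (hty : G.Adj t y) : G.dist x y = 3 := by
  let w := hxz.toWalk.append (hzt.toWalk.append hty.toWalk)
  have hle := SimpleGraph.dist_le w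
  have hr : G.Reachable x y := ⟨w⟩
  have h0 : G.dist x y ≠ 0 := fun h => hne (hr.dist_eq_zero_iff.1 h)
  have h1 : G.dist x y ≠ 1 := fun h => hadj (SimpleGraph.dist_eq_one_iff_adj.1 h)
  have h2 : G.dist x y ≠ 2 := fun h => by
    obtain ⟨p, hp⟩ := hr.exists_walk_length_eq_dist
    rw [h] at hp
    match p, hp with
    | .cons h1 (.cons h2 .nil), _ => exact hcommon _ ⟨h1, h2⟩
  simp [w] at hle
  omega

end Distance

section SmallGraphs

lemma C6_adj_iff (i j : Fin 6) : C6.Adj i j ↔ j = i + 1 ∨ i = j + 1 := by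
  simp only [C6, SimpleGraph.fromRel_adj]
  revert i j
  decide

lemma C6_dist (i j : Fin 6) : C6.dist i j = min (j - i).val (i - j).val := by
  have key : ∀ i j : Fin 6, i = j ∨ (j = i + 1 ∨ i = j + 1) ∨
      (j = i + 1 + 1 ∨ i = j + 1 + 1) ∨ j = i + 1 + 1 + 1 := by decide
  rcases key i j with rfl | h | h | h
  · simp
  · rw [SimpleGraph.dist_eq_one_iff_adj.2 ((C6_adj_iff i j).2 h)]
    revert i j; decide
  · have : C6.dist i j = 2 := by
      rcases h with rfl | rfl
      · refine dist_eq_two (z := i + 1) ?_ ?_ ?_ ?_ <;> (try simp only [C6_adj_iff]) <;>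
          revert i <;> decide
      · refine dist_eq_two (z := j + 1) ?_ ?_ ?_ ?_ <;> (try simp only [C6_adj_iff]) <;>
          revert j <;> decide
    rw [this]
    clear this
    revert i j; decide
  · subst h
    rw [dist_eq_three (z := i + 1) (t := i + 1 + 1)] <;> (try simp only [C6_adj_iff]) <;>
      revert i <;> decide

lemma cubeGraph_adj_iff (x y : Fin 3 → Bool) : cubeGraph.Adj x y ↔ ∃! i, x i ≠ y i := by
  simp only [cubeGraph, SimpleGraph.fromRel_adj]
  constructor
  · rintro ⟨-, h | h⟩
    · exact h
    · simpa only [ne_comm] using h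
  · intro h
    refine ⟨?_, Or.inl h⟩
    rintro rfl
    obtain ⟨i, hi, -⟩ := h
    exact hi rfl

lemma cubeGraph_adj_iff_exists (x y : Fin 3 → Bool) :
    cubeGraph.Adj x y ↔ ∃ i, y = Function.update x i (!x i) := by
  rw [cubeGraph_adj_iff]
  constructor
  · rintro ⟨i, hi, hu⟩
    refine ⟨i, funext fun j => ?_⟩
    by_cases hj : j = i
    · subst hj; simp only [Function.update_self]; revert hi; cases x j <;> cases y j <;> simp
    · rw [Function.update_of_ne hj]
      by_contra hne
      exact hj (hu j (Ne.symm hne))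
  · rintro ⟨i, rfl⟩
    refine ⟨i, by simp, fun j hj => ?_⟩
    by_contra hji
    simp [Function.update_of_ne hji] at hj

/-- In the cube, the antipode of `z` is adjacent to the fourth vertex of any square at `z`. -/
lemma cubeGraph_exists_adj {z v w y : Fin 3 → Bool} (hv : cubeGraph.Adj z v)
    (hw : cubeGraph.Adj z w) (hvw : v ≠ w) (hne : z ≠ y) (hadj : ¬ cubeGraph.Adj z y)
    (hcommon : ∀ s, ¬ (cubeGraph.Adj z s ∧ cubeGraph.Adj s y)) :
    ∃ c, cubeGraph.Adj c v ∧ cubeGraph.Adj c w ∧ cubeGraph.Adj c y := by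
  have hanti : y = fun i => !z i := by
    simp only [cubeGraph_adj_iff_exists] at hadj hcommon
    by_contra hy
    have : ∃ i, y i = z i := by
      by_contra! h
      exact hy (funext fun i => by have := h i; revert this; cases y i <;> cases z i <;> simp)
    obtain ⟨i, hi⟩ := this
    have key : ∀ (z y : Fin 3 → Bool) (i : Fin 3), y i = z i →
        z = y ∨ (∃ j, y = Function.update z j (!z j)) ∨ ∃ s : Fin 3 → Bool,
          (∃ j, s = Function.update z j (!z j)) ∧ ∃ k, y = Function.update s k (!s k) := by
      set_option maxRecDepth 10000 in decide
    rcases key z y i hi with h | h | ⟨s, h⟩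
    · exact hne h
    · exact hadj h
    · exact hcommon s h
  subst hanti
  obtain ⟨i, rfl⟩ := (cubeGraph_adj_iff_exists _ _).1 hv
  obtain ⟨j, rfl⟩ := (cubeGraph_adj_iff_exists _ _).1 hw
  have hij : i ≠ j := by rintro rfl; exact hvw rfl
  refine ⟨Function.update (Function.update z i (!z i)) j (!z j), ?_, ?_, ?_⟩
  · rw [SimpleGraph.adj_comm, cubeGraph_adj_iff_exists]
    exact ⟨j, by rw [Function.update_of_ne hij.symm]⟩
  · rw [SimpleGraph.adj_comm, cubeGraph_adj_iff_exists]
    exact ⟨i, by rw [Function.update_of_ne hij, Function.update_comm hij]⟩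
  · rw [cubeGraph_adj_iff]
    obtain ⟨k, hk⟩ : ∃ k : Fin 3, ∀ l, l ≠ i ∧ l ≠ j ↔ l = k := by
      revert hij; clear * -; revert i j; decide
    refine ⟨k, ?_, fun l hl => ?_⟩
    · have := (hk k).2 rfl
      simp [Function.update_of_ne this.1, Function.update_of_ne this.2]
    · refine (hk l).1 ⟨?_, ?_⟩
      · rintro rfl; simp [Function.update_of_ne hij] at hl
      · rintro rfl; simp at hl

end SmallGraphs

section WeakModularity

variable {X : SimpleGraph V}

/-- Two distinct common neighbours of the endpoints of an edge are adjacent. -/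
lemma IsQuasiMedian.adj_of_common_neighbors (hX : IsQuasiMedian X) {a b c d : V}
    (hab : X.Adj a b) (hac : X.Adj a c) (had : X.Adj a d) (hbc : X.Adj b c) (hbd : X.Adj b d)
    (hcd : c ≠ d) : X.Adj c d := by
  by_contra hn
  have hn' : ¬ X.Adj d c := fun h => hn h.symm
  refine hX.noK112.elim ⟨⟨![a, b, c, d], ?_⟩, ?_⟩
  · intro i j hij
    fin_cases i <;> fin_cases j <;>
      simp_all [hab.ne, hac.ne, had.ne, hbc.ne, hbd.ne, hab.ne', hac.ne', had.ne', hbc.ne',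
        hbd.ne', hcd.symm]
  · intro i j
    change X.Adj (![a, b, c, d] i) (![a, b, c, d] j) ↔ _
    fin_cases i <;> fin_cases j <;>
      simp [K112, hab, hac, had, hbc, hbd, hab.symm, hac.symm, had.symm, hbc.symm, hbd.symm,
        hn, hn']

lemma IsQuasiMedian.triangle_condition (hX : IsQuasiMedian X) {u v w : V}
    (h : X.dist u v = X.dist u w) (hvw : X.Adj v w) :
    ∃ t, X.Adj t v ∧ X.Adj t w ∧ X.dist u t + 1 = X.dist u v := by
  obtain ⟨⟨y₁, y₂, y₃⟩, ⟨k, ⟨g₁₂, g₁₃, g₂₃, k₁₂, k₁₃, k₂₃⟩, -⟩, -⟩ :=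
    hX.uniqueQuasiMedian u v w
  simp only [OnGeod] at *
  have hone := SimpleGraph.dist_eq_one_iff_adj.2 hvw
  have c₂ := X.dist_comm (u := y₂) (v := v)
  obtain rfl | rfl : k = 0 ∨ k = 1 := by omega
  · obtain rfl := hX.connected.dist_eq_zero_iff.1 k₁₂
    obtain rfl := hX.connected.dist_eq_zero_iff.1 k₁₃
    omega
  · obtain rfl := hX.connected.dist_eq_zero_iff.1 (show X.dist v y₂ = 0 by omega)
    obtain rfl := hX.connected.dist_eq_zero_iff.1 (show X.dist y₃ w = 0 by omega)
    refine ⟨y₁, SimpleGraph.dist_eq_one_iff_adj.1 k₁₂, SimpleGraph.dist_eq_one_iff_adj.1 k₁₃, ?_⟩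
    omega

/-- The antipode `y` of `z` in an isometric 6-cycle `y a v z w b` is adjacent to a second common
neighbour of `v` and `w`. -/
lemma IsQuasiMedian.exists_adj_of_hexagon (hX : IsQuasiMedian X) {y a v z w b : V}
    (hya : X.Adj y a) (hav : X.Adj a v) (hvz : X.Adj v z) (hzw : X.Adj z w) (hwb : X.Adj w b)
    (hby : X.Adj b y) (hyv : X.dist y v = 2) (haz : X.dist a z = 2) (hvw : X.dist v w = 2)
    (hzb : X.dist z b = 2) (hwy : X.dist w y = 2) (hba : X.dist b a = 2)
    (hyz : X.dist y z = 3) (haw : X.dist a w = 3) (hvb : X.dist v b = 3) :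
    ∃ c, X.Adj c v ∧ X.Adj c w ∧ X.Adj c y := by
  let f : Fin 6 → V := ![y, a, v, z, w, b]
  have one {s t : V} (h : X.Adj s t) : X.dist s t = 1 := SimpleGraph.dist_eq_one_iff_adj.2 h
  have hdist : ∀ i j, X.dist (f i) (f j) = C6.dist i j := by
    intro i j
    rw [C6_dist]
    fin_cases i <;> fin_cases j <;>
      simp [f, one hya, one hav, one hvz, one hzw, one hwb, one hby, one hya.symm, one hav.symm,
        one hvz.symm, one hzw.symm, one hwb.symm, one hby.symm, hyv, haz, hvw, hzb, hwy, hba,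
        hyz, haw, hvb, X.dist_comm (u := v) (v := y), X.dist_comm (u := z) (v := a),
        X.dist_comm (u := w) (v := v), X.dist_comm (u := b) (v := z),
        X.dist_comm (u := y) (v := w), X.dist_comm (u := a) (v := b),
        X.dist_comm (u := z) (v := y), X.dist_comm (u := w) (v := a),
        X.dist_comm (u := b) (v := v)] <;> decide
  have hadj : ∀ i j, C6.Adj i j → X.Adj (f i) (f j) := fun i j h => by
    rw [← SimpleGraph.dist_eq_one_iff_adj, hdist, SimpleGraph.dist_eq_one_iff_adj]
    exact h
  obtain ⟨φ⟩ := hX.hullOfC6IsCube f hadj hdist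
  have hmem (i : Fin 6) : f i ∈ convexHullSet X (Set.range f) :=
    Set.mem_sInter.2 fun T hT => hT.1 (Set.mem_range_self i)
  let p (i : Fin 6) : convexHullSet X (Set.range f) := ⟨f i, hmem i⟩
  have hne : φ (p 3) ≠ φ (p 0) := fun h => by
    have h' : z = y := congrArg Subtype.val (φ.injective h)
    subst h'
    simp at hyz
  have hvw' : φ (p 2) ≠ φ (p 4) := fun h => by
    have h' : v = w := congrArg Subtype.val (φ.injective h)
    subst h'
    simp at hvw
  obtain ⟨c, hcv, hcw, hcy⟩ := cubeGraph_exists_adj (z := φ (p 3)) (v := φ (p 2)) (w := φ (p 4))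
    (y := φ (p 0)) (φ.map_adj_iff.2 hvz.symm) (φ.map_adj_iff.2 hzw) hvw' hne
    (fun h => by
      have h' : X.Adj z y := φ.map_adj_iff.1 h
      have := one h'.symm
      omega)
    (fun s hs => by
      obtain ⟨s, rfl⟩ := φ.surjective s
      have h₁ : X.Adj z s := φ.map_adj_iff.1 hs.1
      have h₂ : X.Adj s y := φ.map_adj_iff.1 hs.2
      have := one h₁.symm
      have := one h₂.symm
      have := hX.connected.dist_triangle (u := y) (v := s.1) (w := z)
      omega)
  obtain ⟨c, rfl⟩ := φ.surjective c
  exact ⟨c.1, φ.map_adj_iff.1 hcv, φ.map_adj_iff.1 hcw, φ.map_adj_iff.1 hcy⟩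

lemma IsQuasiMedian.quadrangle_condition (hX : IsQuasiMedian X) {u v w z : V}
    (huw : X.dist u v = X.dist u w) (huz : X.dist u z = X.dist u v + 1)
    (hvz : X.Adj v z) (hwz : X.Adj w z) (hne : v ≠ w) (hvw : ¬ X.Adj v w) :
    ∃ t, X.Adj t v ∧ X.Adj t w ∧ X.dist u t + 1 = X.dist u v := by
  have one {s t : V} (h : X.Adj s t) : X.dist s t = 1 := SimpleGraph.dist_eq_one_iff_adj.2 h
  have tri (r s t : V) : X.dist r t ≤ X.dist r s + X.dist s t := hX.connected.dist_triangle
  have htwo : X.dist v w = 2 := dist_eq_two hne hvw hvz hwz.symm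
  have far : ∀ v w a, X.dist u v = X.dist u w → X.dist u z = X.dist u v + 1 → X.Adj v z →
      X.Adj w z → X.Adj a v → X.dist u a + 1 = X.dist u v → ¬ X.Adj a w → X.dist a w = 3 := by
    intro v w a huw huz hvz hwz hav hua haw
    have haz : X.dist a z = 2 := by
      have := tri u a z
      have := tri a v z
      have := one hav
      have := one hvz
      omega
    have h1 : X.dist a w ≠ 1 := fun h => haw (SimpleGraph.dist_eq_one_iff_adj.1 h)
    have h2 : X.dist a w ≠ 2 := fun h => by
      obtain ⟨t, htw, htz, hat⟩ := hX.triangle_condition (h.trans haz.symm) hwz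
      have := tri u a t
      have := tri u t z
      have := one htz
      obtain ⟨s, hst, hsw, hus⟩ := hX.triangle_condition
        (show X.dist u t = X.dist u w by omega) htw
      have hzs := one (hX.adj_of_common_neighbors htw htz hst.symm hwz hsw.symm
        (fun e => by subst e; omega))
      have := tri u s z
      have := X.dist_comm (u := s) (v := z)
      omega
    have := tri u a w
    have := tri a z w
    have := one hwz.symm
    omega
  obtain ⟨⟨y₁, y₂, y₃⟩, ⟨k, ⟨g₁₂, g₁₃, g₂₃, k₁₂, k₁₃, k₂₃⟩, -⟩, -⟩ :=
    hX.uniqueQuasiMedian u v w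
  simp only [OnGeod] at *
  have c₂ := X.dist_comm (u := y₂) (v := v)
  have c₃ := X.dist_comm (u := y₃) (v := w)
  obtain rfl | rfl | rfl : k = 0 ∨ k = 1 ∨ k = 2 := by omega
  · obtain rfl := hX.connected.dist_eq_zero_iff.1 k₁₂
    obtain rfl := hX.connected.dist_eq_zero_iff.1 k₁₃
    exact ⟨y₁, SimpleGraph.dist_eq_one_iff_adj.1 (by omega),
      SimpleGraph.dist_eq_one_iff_adj.1 (by omega), by omega⟩
  · omega
  · obtain rfl := hX.connected.dist_eq_zero_iff.1 (show X.dist v y₂ = 0 by omega)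
    obtain rfl := (hX.connected.dist_eq_zero_iff.1 (show X.dist y₃ w = 0 by omega)).symm
    clear c₂ c₃ k₂₃ g₂₃
    obtain ⟨a, hya, ha⟩ := exists_adj_dist_eq hX.connected k₁₂
    obtain ⟨b, hyb, hb⟩ := exists_adj_dist_eq hX.connected k₁₃
    have hav := SimpleGraph.dist_eq_one_iff_adj.1 ha
    have hbw := SimpleGraph.dist_eq_one_iff_adj.1 hb
    have hua : X.dist u a + 1 = X.dist u v := by
      have := tri u y₁ a
      have := tri u a v
      have := one hya
      omega
    have hub : X.dist u b + 1 = X.dist u v := by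
      have := tri u y₁ b
      have := tri u b w
      have := one hyb
      omega
    by_cases haw : X.Adj a w
    · exact ⟨a, hav, haw, hua⟩
    by_cases hbv : X.Adj b v
    · exact ⟨b, hbv, hbw, hub⟩
    have haw₃ := far v w a huw huz hvz hwz hav hua haw
    have hbv₃ := far w v b huw.symm (by omega) hwz hvz hbw (by omega) hbv
    have hba : ¬ X.Adj b a := fun h => by
      have := tri a b w
      have := one h.symm
      omega
    have hne_ba : b ≠ a := fun h => haw (h ▸ hbw)
    obtain ⟨c, hcv, hcw, hcy⟩ := hX.exists_adj_of_hexagon hya hav hvz hwz.symm hbw.symm hyb.symm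
      k₁₂ (by have := tri u a z; have := tri a v z; have := one hvz; omega) htwo
      (by
        have := tri u b z
        have := tri b w z
        have := one hwz
        have := X.dist_comm (u := z) (v := b)
        omega)
      (X.dist_comm.trans k₁₃) (dist_eq_two hne_ba hba hyb.symm hya)
      (by have := tri u y₁ z; have := tri y₁ v z; have := one hvz; omega)
      haw₃ (X.dist_comm.trans hbv₃)
    refine ⟨c, hcv, hcw, ?_⟩
    have := tri u y₁ c
    have := tri u c v
    have := one hcy.symm
    have := one hcv
    omega

end WeakModularity

section Separation

variable {X : SimpleGraph V}

/-- Parallel edges, at distance `n` from each other, are dual to the same hyperplane. -/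
lemma IsQuasiMedian.eqvGen_of_dist (hX : IsQuasiMedian X) {a b : V} (n : ℕ) :
    ∀ x y : V, X.Adj x y → X.Adj a b → X.dist a x = n → X.dist b y = n →
      X.dist b x = n + 1 → X.dist a y = n + 1 →
      Relation.EqvGen (SideRel X) s(a, b) s(x, y) := by
  induction n with
  | zero =>
    intro x y _ _ hax hby _ _
    obtain rfl := hX.connected.dist_eq_zero_iff.1 hax
    obtain rfl := hX.connected.dist_eq_zero_iff.1 hby
    exact .refl _
  | succ n ih =>
    intro x y hxy hab hax hby hbx hay
    have tri (r s t : V) : X.dist r t ≤ X.dist r s + X.dist s t := hX.connected.dist_triangle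
    have one {s t : V} (h : X.Adj s t) : X.dist s t = 1 := SimpleGraph.dist_eq_one_iff_adj.2 h
    obtain ⟨x', hxx', hxa_dist⟩ := exists_adj_dist_eq hX.connected (X.dist_comm.trans hax)
    have hax' : X.dist a x' = n := X.dist_comm.trans hxa_dist
    have hbx' : X.dist b x' = n + 1 := by
      have := tri b a x'
      have := tri b x' x
      have := one hab.symm
      have := one hxx'.symm
      omega
    have hxy_nadj : ¬ X.Adj x' y := fun h => by
      have := tri a x' y
      have := one h
      omega
    have hne : x' ≠ y := by rintro rfl; omega
    obtain ⟨y', hyx_adj, hyy_adj, hby'⟩ := hX.quadrangle_condition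
      (u := b) (v := x') (w := y) (z := x) (by omega) (by omega) hxx'.symm hxy.symm hne hxy_nadj
    have hay' : X.dist a y' = n + 1 := by
      have := tri a b y'
      have := tri a y' y
      have := one hab
      have := one hyy_adj
      omega
    refine (ih x' y' hyx_adj.symm hab hax' (by omega) hbx' hay').trans _ _ _ (.rel _ _ (.inr ?_))
    exact ⟨x', y', x, y, hyx_adj.symm, hxy, hxx'.symm, hyy_adj, hne,
      fun h => by subst h; omega, rfl, rfl⟩

lemma exists_adj_of_walk {p q : V} (w : X.Walk p q) (S : V → Prop) (hp : S p) (hq : ¬ S q) :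
    ∃ x y, s(x, y) ∈ w.edges ∧ X.Adj x y ∧ S x ∧ ¬ S y := by
  induction w with
  | nil => exact absurd hp hq
  | @cons u v _ h w ih =>
    by_cases hv : S v
    · obtain ⟨x, y, he, h'⟩ := ih hv hq
      exact ⟨x, y, by simp [he], h'⟩
    · exact ⟨u, v, by simp, h, hp, hv⟩

/-- The hyperplane dual to an edge of a geodesic separates its endpoints. -/
lemma IsQuasiMedian.separates_of_geodesic (hX : IsQuasiMedian X) {p q a b : V}
    (hab : X.Adj a b) (hgeod : X.dist p a + 1 + X.dist b q = X.dist p q) :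
    Separates X (hypClass X s(a, b)) p q := by
  have tri (r s t : V) : X.dist r t ≤ X.dist r s + X.dist s t := hX.connected.dist_triangle
  have one {s t : V} (h : X.Adj s t) : X.dist s t = 1 := SimpleGraph.dist_eq_one_iff_adj.2 h
  have hpb : X.dist p b = X.dist p a + 1 := by
    have := tri p b q
    have := tri p a b
    have := one hab
    omega
  have hqa : X.dist q a = X.dist q b + 1 := by
    have := tri p a q
    have := tri q b a
    have := one hab.symm
    have := X.dist_comm (u := b) (v := q)
    have := X.dist_comm (u := a) (v := q)
    omega
  let C (z : V) : Prop := z = b ∨ X.Adj z b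
  have hC {z t : V} (hz : C z) (hza : X.Adj z a) (htz : X.Adj t z) (hta : X.Adj t a) : C t := by
    rcases hz with rfl | hz
    · exact .inr htz
    · by_cases htb : t = b
      · exact .inl htb
      · exact .inr (hX.adj_of_common_neighbors hza htz.symm hz hta.symm hab htb)
  intro w
  obtain ⟨x, y, he, hxy, hx, hy⟩ := exists_adj_of_walk w
    (fun v => ∀ z, X.Adj z a → C z → X.dist v a < X.dist v z) (by
      intro z hza hz
      by_contra! hle
      have hzb : X.dist z b ≤ 1 := by
        rcases hz with rfl | hz
        · simp
        · exact (one hz).le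
      have := tri p z b
      have heq : X.dist p z = X.dist p a := by omega
      obtain ⟨t, htz, hta, hpt⟩ := hX.triangle_condition heq hza
      have htb : X.dist t b ≤ 1 := by
        rcases hC hz hza htz hta with rfl | h
        · simp
        · exact (one h).le
      have := tri p t b
      omega)
    (fun h => by have := h b hab.symm (.inl rfl); omega)
  simp only [not_forall, not_lt] at hy
  obtain ⟨z, hza, hz, hyz⟩ := hy
  obtain ⟨c, hca, hc, hyc⟩ : ∃ c, X.Adj c a ∧ C c ∧ X.dist y c < X.dist y a := by
    rcases hyz.lt_or_eq with h | h
    · exact ⟨z, hza, hz, h⟩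
    · obtain ⟨t, htz, hta, hyt⟩ := hX.triangle_condition h hza
      exact ⟨t, hta, hC hz hza htz hta, by omega⟩
  refine ⟨s(x, y), he, ?_⟩
  have hac : Relation.EqvGen (SideRel X) s(a, b) s(a, c) := by
    rcases hc with rfl | hc
    · exact .refl _
    · exact .rel _ _ (.inl ⟨a, b, c, hab, hca.symm, hc.symm, rfl, rfl⟩)
  have hxc := hx c hca hc
  have h1 := tri x a c
  have h2 := tri y c a
  have h3 := one hca
  have h4 := one hca.symm
  have h5 := tri x y c
  have h6 := tri y x a
  have h7 := one hxy
  have h8 := one hxy.symm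
  refine hac.trans _ _ _ (hX.eqvGen_of_dist (X.dist a x) x y hxy hca.symm rfl ?_ ?_ ?_) <;>
    simp only [X.dist_comm (u := a), X.dist_comm (u := c) (v := x),
      X.dist_comm (u := c) (v := y)] <;> omega

end Separation

section Hyperplanes

variable {X : SimpleGraph V}

lemma mem_edgeSet_iff_of_eqvGen {e f : Sym2 V} (h : Relation.EqvGen (SideRel X) e f) :
    e ∈ X.edgeSet ↔ f ∈ X.edgeSet := by
  induction h with
  | rel e f h =>
    rcases h with ⟨a, b, c, hab, hac, -, rfl, rfl⟩ | ⟨a, b, c, d, hab, hcd, -, -, -, -, rfl, rfl⟩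
    · simp [hab, hac]
    · simp [hab, hcd]
  | refl => rfl
  | symm _ _ _ ih => exact ih.symm
  | trans _ _ _ _ _ ih₁ ih₂ => exact ih₁.trans ih₂

lemma Hyperplane.eq_hypClass (K : Hyperplane X) {e : Sym2 V} (he : e ∈ K.1) :
    K.1 = hypClass X e := by
  obtain ⟨e₀, -, h⟩ := K.2
  rw [h] at he ⊢
  ext f
  exact ⟨fun hf => (Relation.EqvGen.symm _ _ he).trans _ _ _ hf, fun hf => he.trans _ _ _ hf⟩

lemma Hyperplane.mem_edgeSet (K : Hyperplane X) {e : Sym2 V} (he : e ∈ K.1) : e ∈ X.edgeSet := by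
  obtain ⟨e₀, he₀, h⟩ := K.2
  rw [h] at he
  exact (mem_edgeSet_iff_of_eqvGen he).1 he₀

lemma Hyperplane.eq_of_mem {K L : Hyperplane X} {e : Sym2 V} (hK : e ∈ K.1) (hL : e ∈ L.1) :
    K = L :=
  Subtype.ext ((K.eq_hypClass hK).trans (L.eq_hypClass hL).symm)

/-- The hyperplane dual to an edge. -/
def dualHyperplane {a b : V} (h : X.Adj a b) : Hyperplane X :=
  ⟨hypClass X s(a, b), s(a, b), h, rfl⟩

lemma mem_dualHyperplane {a b : V} (h : X.Adj a b) : s(a, b) ∈ (dualHyperplane h).1 :=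
  .refl _

lemma fst_mem_hypCarrier {a b : V} (h : X.Adj a b) : a ∈ hypCarrier X (dualHyperplane h) :=
  ⟨_, mem_dualHyperplane h, by simp⟩

lemma snd_mem_hypCarrier {a b : V} (h : X.Adj a b) : b ∈ hypCarrier X (dualHyperplane h) :=
  ⟨_, mem_dualHyperplane h, by simp⟩

/-- Hyperplanes with intersecting carriers are equal or adjacent in the contact graph. -/
lemma eq_or_adj_of_mem_hypCarrier {K L : Hyperplane X} {v : V} (hK : v ∈ hypCarrier X K)
    (hL : v ∈ hypCarrier X L) : K = L ∨ (contactGraph X).Adj K L := by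
  obtain ⟨e, he, hve⟩ := hK
  obtain ⟨f, hf, hvf⟩ := hL
  obtain ⟨a, rfl⟩ := hve
  obtain ⟨b, rfl⟩ := hvf
  have hva : X.Adj v a := K.mem_edgeSet he
  have hvb : X.Adj v b := L.mem_edgeSet hf
  by_cases hKL : K = L
  · exact .inl hKL
  right
  have hab : a ≠ b := by
    rintro rfl
    exact hKL (Hyperplane.eq_of_mem he hf)
  have hnadj : ¬ X.Adj a b := fun h => by
    have : s(v, b) ∈ K.1 := by
      rw [K.eq_hypClass he]
      exact .rel _ _ (.inl ⟨v, a, b, hva, hvb, h, rfl, rfl⟩)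
    exact hKL (Hyperplane.eq_of_mem this hf)
  refine (SimpleGraph.fromRel_adj _ _ _).2 ⟨hKL, .inl ?_⟩
  by_cases hq : ∃ q : V, q ≠ v ∧ X.Adj a q ∧ X.Adj b q
  · exact .inl ⟨v, _, he, _, hf, a, b, rfl, rfl, hva, hvb, hab, hnadj, hq⟩
  · exact .inr ⟨v, _, he, _, hf, a, b, rfl, rfl, hva, hvb, hab, hnadj, hq⟩

lemma dist_le_one_of_mem_hypCarrier {K L : Hyperplane X} {v : V} (hK : v ∈ hypCarrier X K)
    (hL : v ∈ hypCarrier X L) : (contactGraph X).dist K L ≤ 1 := by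
  rcases eq_or_adj_of_mem_hypCarrier hK hL with rfl | h
  · simp
  · exact (SimpleGraph.dist_eq_one_iff_adj.2 h).le

lemma exists_mem_hypCarrier_of_adj {K L : Hyperplane X} (h : (contactGraph X).Adj K L) :
    ∃ v, v ∈ hypCarrier X K ∧ v ∈ hypCarrier X L := by
  rcases ((SimpleGraph.fromRel_adj _ _ _).1 h).2 with (h | h) | (h | h) <;>
    obtain ⟨p, e, he, f, hf, a, b, rfl, rfl, -⟩ := h
  · exact ⟨p, ⟨_, he, by simp⟩, ⟨_, hf, by simp⟩⟩
  · exact ⟨p, ⟨_, he, by simp⟩, ⟨_, hf, by simp⟩⟩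
  · exact ⟨p, ⟨_, hf, by simp⟩, ⟨_, he, by simp⟩⟩
  · exact ⟨p, ⟨_, hf, by simp⟩, ⟨_, he, by simp⟩⟩

lemma hypCarrier_nonempty (K : Hyperplane X) : ∃ v, v ∈ hypCarrier X K := by
  obtain ⟨K, e, he, rfl⟩ := K
  induction e with
  | _ a b => exact ⟨a, _, .refl _, by simp⟩

lemma contactGraph_reachable_of_walk {u v : V} (w : X.Walk u v) : ∀ {K L : Hyperplane X},
    u ∈ hypCarrier X K → v ∈ hypCarrier X L → (contactGraph X).Reachable K L := by
  have base {K L : Hyperplane X} {v : V} (hK : v ∈ hypCarrier X K) (hL : v ∈ hypCarrier X L) :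
      (contactGraph X).Reachable K L := by
    rcases eq_or_adj_of_mem_hypCarrier hK hL with rfl | h
    · rfl
    · exact h.reachable
  induction w with
  | nil => exact base
  | cons h w ih =>
    intro K L hK hL
    exact (base hK (fst_mem_hypCarrier h)).trans (ih (snd_mem_hypCarrier h) hL)

lemma contactGraph_preconnected (hX : X.Connected) : (contactGraph X).Preconnected := fun K L => by
  obtain ⟨u, hu⟩ := hypCarrier_nonempty K
  obtain ⟨v, hv⟩ := hypCarrier_nonempty L
  obtain ⟨w⟩ := hX u v
  exact contactGraph_reachable_of_walk w hu hv

/-- Carriers of hyperplanes are connected. -/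
lemma exists_walk_of_eqvGen {e f : Sym2 V} (h : Relation.EqvGen (SideRel X) e f) :
    ∀ K : Hyperplane X, e ∈ K.1 → ∀ u ∈ e, ∀ v ∈ f,
      ∃ w : X.Walk u v, ∀ x ∈ w.support, x ∈ hypCarrier X K := by
  have edge {K : Hyperplane X} {e : Sym2 V} (he : e ∈ K.1) {u v : V} (hu : u ∈ e) (hv : v ∈ e) :
      ∃ w : X.Walk u v, ∀ x ∈ w.support, x ∈ hypCarrier X K := by
    by_cases huv : u = v
    · subst huv
      exact ⟨.nil, by simpa using ⟨e, he, hu⟩⟩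
    · obtain rfl := (Sym2.mem_and_mem_iff huv).1 ⟨hu, hv⟩
      have huv : X.Adj u v := K.mem_edgeSet he
      exact ⟨huv.toWalk, by simpa using ⟨⟨_, he, hu⟩, ⟨_, he, hv⟩⟩⟩
  have append {K : Hyperplane X} {u v t : V}
      (h₁ : ∃ w : X.Walk u v, ∀ x ∈ w.support, x ∈ hypCarrier X K)
      (h₂ : ∃ w : X.Walk v t, ∀ x ∈ w.support, x ∈ hypCarrier X K) :
      ∃ w : X.Walk u t, ∀ x ∈ w.support, x ∈ hypCarrier X K := by
    obtain ⟨w₁, h₁⟩ := h₁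
    obtain ⟨w₂, h₂⟩ := h₂
    exact ⟨w₁.append w₂, fun x hx =>
      ((SimpleGraph.Walk.mem_support_append_iff _ _).1 hx).elim (h₁ x) (h₂ x)⟩
  have mem {K : Hyperplane X} {e f : Sym2 V} (he : e ∈ K.1)
      (h : Relation.EqvGen (SideRel X) e f) : f ∈ K.1 := by
    rw [K.eq_hypClass he]; exact h
  induction h with
  | refl e => exact fun K he u hu v hv => edge he hu hv
  | symm e f h ih =>
    intro K hf u hu v hv
    obtain ⟨w, hw⟩ := ih K (mem hf (h.symm _ _)) v hv u hu
    exact ⟨w.reverse, by simpa using hw⟩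
  | trans e f g h _ ih₁ ih₂ =>
    intro K he u hu v hv
    obtain ⟨m, hm⟩ : ∃ m, m ∈ f := by
      induction f with
      | _ a b => exact ⟨a, by simp⟩
    exact append (ih₁ K he u hu m hm) (ih₂ K (mem he h) m hm v hv)
  | rel e f h =>
    intro K he u hu v hv
    have hf := mem he (.rel _ _ h)
    rcases h with ⟨a, b, c, -, -, -, rfl, rfl⟩ | ⟨a, b, c, d, -, -, hac, -, -, -, rfl, rfl⟩
    · exact append (edge he hu (by simp)) (edge (v := v) hf (u := a) (by simp) hv)
    · refine append (edge he hu (v := a) (by simp)) (append (v := c) ⟨hac.toWalk, ?_⟩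
        (edge hf (by simp) hv))
      simpa using ⟨⟨_, he, by simp⟩, ⟨_, hf, by simp⟩⟩

lemma exists_walk_in_hypCarrier {K : Hyperplane X} {u v : V} (hu : u ∈ hypCarrier X K)
    (hv : v ∈ hypCarrier X K) : ∃ w : X.Walk u v, ∀ x ∈ w.support, x ∈ hypCarrier X K := by
  obtain ⟨e, he, hue⟩ := hu
  obtain ⟨f, hf, hvf⟩ := hv
  rw [K.eq_hypClass he] at hf
  exact exists_walk_of_eqvGen hf K he u hue v hvf

/-- A walk in the contact graph can be followed in `X` through the carriers of its vertices. -/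
lemma exists_walk_along {A B : Hyperplane X} (W : (contactGraph X).Walk A B) : ∀ {u v : V},
    u ∈ hypCarrier X A → v ∈ hypCarrier X B →
    ∃ w : X.Walk u v, ∀ x ∈ w.support, ∃ L ∈ W.support, x ∈ hypCarrier X L := by
  induction W with
  | nil =>
    intro u v hu hv
    obtain ⟨w, hw⟩ := exists_walk_in_hypCarrier hu hv
    exact ⟨w, fun x hx => ⟨_, by simp, hw x hx⟩⟩
  | cons h W ih =>
    intro u v hu hv
    obtain ⟨m, hm, hm'⟩ := exists_mem_hypCarrier_of_adj h
    obtain ⟨w₁, hw₁⟩ := exists_walk_in_hypCarrier hu hm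
    obtain ⟨w₂, hw₂⟩ := ih hm' hv
    refine ⟨w₁.append w₂, fun x hx => ?_⟩
    rcases (SimpleGraph.Walk.mem_support_append_iff _ _).1 hx with hx | hx
    · exact ⟨_, by simp, hw₁ x hx⟩
    · obtain ⟨L, hL, hxL⟩ := hw₂ x hx
      exact ⟨L, by simp [hL], hxL⟩

end Hyperplanes

section Bottleneck

variable {X : SimpleGraph V}

lemma dist_add_dist_le_length {W : Type*} {G : SimpleGraph W} {x y z : W} (w : G.Walk x y)
    (hz : z ∈ w.support) : G.dist x z + G.dist z y ≤ w.length := by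
  obtain ⟨w₁, w₂, rfl⟩ := SimpleGraph.Walk.mem_support_iff_exists_append.1 hz
  rw [SimpleGraph.Walk.length_append]
  exact add_le_add (SimpleGraph.dist_le w₁) (SimpleGraph.dist_le w₂)

/-- Along a geodesic of `X` the dual hyperplanes leave every ball of the contact graph
one step at a time. -/
lemma exists_geodesic_edge_dist_eq (hX : X.Connected) {R C : Hyperplane X} {k : ℕ} {p q : V}
    (hq : q ∈ hypCarrier X C) (hC : k + 2 ≤ (contactGraph X).dist R C) (m : ℕ) :
    ∀ (u : V) (K : Hyperplane X), X.dist u q = m → u ∈ hypCarrier X K →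
      (contactGraph X).dist R K ≤ k → X.dist p u + m = X.dist p q →
      ∃ (a b : V) (h : X.Adj a b), X.dist p a + 1 + X.dist b q = X.dist p q ∧
        (contactGraph X).dist R (dualHyperplane h) = k + 1 := by
  have tri (A B C : Hyperplane X) : (contactGraph X).dist A C ≤
      (contactGraph X).dist A B + (contactGraph X).dist B C :=
    (contactGraph_preconnected hX A B).dist_triangle_left C
  induction m with
  | zero =>
    intro u K hu huK hK _
    obtain rfl := hX.dist_eq_zero_iff.1 hu
    have := tri R K C
    have := dist_le_one_of_mem_hypCarrier huK hq
    omega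
  | succ m ih =>
    intro u K hu huK hK hpu
    obtain ⟨u', huu', hu'⟩ := exists_adj_dist_eq hX hu
    have h1 := tri R K (dualHyperplane huu')
    have h2 := dist_le_one_of_mem_hypCarrier huK (fst_mem_hypCarrier huu')
    by_cases hk : (contactGraph X).dist R (dualHyperplane huu') = k + 1
    · exact ⟨u, u', huu', by omega, hk⟩
    · refine ih u' _ hu' (snd_mem_hypCarrier huu') (by omega) ?_
      have := hX.dist_triangle (u := p) (v := u) (w := u')
      have := hX.dist_triangle (u := p) (v := u') (w := q)
      have := SimpleGraph.dist_eq_one_iff_adj.2 huu'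
      omega

lemma exists_mem_hypCarrier_of_separates {p q : V} {J A B : Hyperplane X}
    (hJ : Separates X J.1 p q) (W : (contactGraph X).Walk A B) (hp : p ∈ hypCarrier X A)
    (hq : q ∈ hypCarrier X B) : ∃ L ∈ W.support, (contactGraph X).dist J L ≤ 1 := by
  obtain ⟨w, hw⟩ := exists_walk_along W hp hq
  obtain ⟨e, he, heJ⟩ := hJ w
  induction e with
  | _ a b =>
    obtain ⟨L, hL, ha⟩ := hw a (w.fst_mem_support_of_mem_edges he)
    exact ⟨L, hL, dist_le_one_of_mem_hypCarrier ⟨_, heJ, by simp⟩ ha⟩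

/-- Hyperplanes on a sphere of the contact graph which are connected outside the open ball
are at bounded distance. -/
lemma IsQuasiMedian.dist_le_of_walk (hX : IsQuasiMedian X) (R : Hyperplane X) {A B : Hyperplane X}
    (hAB : (contactGraph X).dist R A = (contactGraph X).dist R B) (W : (contactGraph X).Walk A B)
    (hW : ∀ K ∈ W.support, (contactGraph X).dist R A ≤ (contactGraph X).dist R K) :
    (contactGraph X).dist A B ≤ 8 := by
  have tri (A B C : Hyperplane X) : (contactGraph X).dist A C ≤
      (contactGraph X).dist A B + (contactGraph X).dist B C :=
    (contactGraph_preconnected hX.connected A B).dist_triangle_left C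
  by_cases hn : (contactGraph X).dist R A < 3
  · have := tri A R B
    have := (contactGraph X).dist_comm (u := A) (v := R)
    omega
  obtain ⟨n, hRA⟩ := Nat.exists_eq_add_of_le' (not_lt.1 hn)
  obtain ⟨x, hx⟩ := hypCarrier_nonempty R
  obtain ⟨p, hp⟩ := hypCarrier_nonempty A
  obtain ⟨q, hq⟩ := hypCarrier_nonempty B
  obtain ⟨a, b, hab, hgeod, hJ⟩ := exists_geodesic_edge_dist_eq (R := R) (k := n) (p := x)
    hX.connected
    hp (by omega) (X.dist x p) x R rfl hx (by simp) (by simp)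
  have hsep := hX.separates_of_geodesic hab hgeod
  set J := dualHyperplane hab
  change Separates X J.1 x p at hsep
  have hsep' : Separates X J.1 x q := by
    obtain ⟨w₁, hw₁⟩ := exists_walk_along W hp hq
    intro w
    obtain ⟨e, he, heJ⟩ := hsep (w.append w₁.reverse)
    rw [SimpleGraph.Walk.edges_append, List.mem_append] at he
    refine ⟨e, he.resolve_right fun he => ?_, heJ⟩
    rw [SimpleGraph.Walk.edges_reverse, List.mem_reverse] at he
    induction e with
    | _ s t =>
      obtain ⟨L, hL, hs⟩ := hw₁ s (w₁.fst_mem_support_of_mem_edges he)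
      have := dist_le_one_of_mem_hypCarrier ⟨_, heJ, by simp⟩ hs
      have := tri R J L
      have := hW L hL
      omega
  have near {C : Hyperplane X} {c : V} (hC : (contactGraph X).dist R C = n + 3)
      (hc : c ∈ hypCarrier X C) (hJc : Separates X J.1 x c) : (contactGraph X).dist J C ≤ 4 := by
    obtain ⟨W', hW'⟩ :=
      (contactGraph_preconnected hX.connected R C).exists_walk_length_eq_dist
    obtain ⟨L, hL, hJL⟩ := exists_mem_hypCarrier_of_separates hJc W' hx hc
    have := dist_add_dist_le_length W' hL
    have := tri R L J
    have := tri J L C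
    have := (contactGraph X).dist_comm (u := J) (v := L)
    omega
  have h1 := near hRA hp hsep
  have h2 := near (hAB.symm.trans hRA) hq hsep'
  have := tri A J B
  have := (contactGraph X).dist_comm (u := A) (v := J)
  omega

end Bottleneck

section LayeringTree

variable {W : Type*}

/-- The graph joining every vertex to its parent. -/
def parentGraph (par : W → W) : SimpleGraph W := SimpleGraph.fromRel fun x y => par x = y

lemma parentGraph_preconnected (par : W → W) (ℓ : W → ℕ) (r : W)
    (hℓ : ∀ x, x ≠ r → ℓ (par x) < ℓ x) : (parentGraph par).Preconnected := by
  have key : ∀ n x, ℓ x = n → (parentGraph par).Reachable x r := by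
    intro n
    induction n using Nat.strong_induction_on with
    | _ n ih =>
      intro x hx
      by_cases hxr : x = r
      · subst hxr; rfl
      · have hlt := hℓ x hxr
        have hadj : (parentGraph par).Adj x (par x) :=
          (SimpleGraph.fromRel_adj _ _ _).2 ⟨fun h => by rw [← h] at hlt; omega, .inl rfl⟩
        exact hadj.reachable.trans (ih _ (hx ▸ hlt) _ rfl)
  exact fun x y => (key _ x rfl).trans (key _ y rfl).symm

lemma parentGraph_isAcyclic (par : W → W) (ℓ : W → ℕ)
    (hℓ : ∀ x, par x ≠ x → ℓ (par x) < ℓ x) : (parentGraph par).IsAcyclic := by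
  have hle : ∀ k x, ℓ (par^[k] x) ≤ ℓ x := by
    intro k
    induction k with
    | zero => simp
    | succ k ih =>
      intro x
      rw [Function.iterate_succ_apply]
      refine (ih _).trans ?_
      by_cases h : par x = x
      · rw [h]
      · exact (hℓ x h).le
  have bridge : ∀ t, par t ≠ t → (parentGraph par).IsBridge s(t, par t) := by
    intro t ht
    rw [SimpleGraph.isBridge_iff]
    rintro ⟨w⟩
    have hnot : ¬ ∃ k, par^[k] (par t) = t := by
      rintro ⟨k, hk⟩
      have := hle k (par t)
      have := hℓ t ht
      rw [hk] at *
      omega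
    obtain ⟨x, y, -, hxy, hx, hy⟩ := exists_adj_of_walk w (fun s => ∃ k, par^[k] s = t)
      ⟨0, rfl⟩ hnot
    simp only [SimpleGraph.deleteEdges_adj, parentGraph, SimpleGraph.fromRel_adj,
      Set.mem_singleton_iff] at hxy
    obtain ⟨⟨hne, h | h⟩, hmem⟩ := hxy
    · obtain ⟨_ | k, hk⟩ := hx
      · rw [Function.iterate_zero_apply] at hk
        subst hk
        subst h
        exact hmem rfl
      · exact hy ⟨k, by rwa [Function.iterate_succ_apply, h] at hk⟩
    · obtain ⟨k, hk⟩ := hx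
      exact hy ⟨k + 1, by rwa [Function.iterate_succ_apply, h]⟩
  rw [SimpleGraph.isAcyclic_iff_forall_adj_isBridge]
  intro x y hxy
  obtain ⟨hne, h | h⟩ := (SimpleGraph.fromRel_adj _ _ _).1 hxy
  · subst h
    exact bridge x hne.symm
  · subst h
    rw [Sym2.eq_swap]
    exact bridge y hne

lemma dist_le_mul_dist {G H : SimpleGraph W} (hG : G.Preconnected) (hH : H.Preconnected) {c : ℕ}
    (h : ∀ x y, G.Adj x y → H.dist x y ≤ c) (x y : W) : H.dist x y ≤ c * G.dist x y := by
  obtain ⟨w, hw⟩ := (hG x y).exists_walk_length_eq_dist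
  rw [← hw]
  clear hw
  induction w with
  | nil => simp
  | @cons u v _ huv w ih =>
    have h1 := (hH u v).dist_triangle_left
    have h2 := h u v huv
    rw [SimpleGraph.Walk.length_cons, mul_add, mul_one]
    have := h1 ‹_›
    omega

/-- Two vertices lie in the same cluster of the layering of `G` from `r` if they are at the same
distance from `r` and connected by a walk which does not come closer to `r`. -/
def clusterSetoid (G : SimpleGraph W) (r : W) : Setoid W where
  r x y := G.dist r x = G.dist r y ∧
    ∃ w : G.Walk x y, ∀ z ∈ w.support, G.dist r x ≤ G.dist r z
  iseqv :=
    { refl := fun x => ⟨rfl, .nil, by simp⟩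
      symm := by
        rintro x y ⟨h, w, hw⟩
        exact ⟨h.symm, w.reverse, fun z hz => h ▸ hw z (by simpa using hz)⟩
      trans := by
        rintro x y z ⟨h, w, hw⟩ ⟨h', w', hw'⟩
        exact ⟨h.trans h', w.append w', fun t ht =>
          ((SimpleGraph.Walk.mem_support_append_iff _ _).1 ht).elim (hw t)
            (fun ht => h ▸ hw' t ht)⟩ }

/-- A connected graph whose layering from `r` has clusters of diameter at most `D` is
quasi-isometric to a tree on its vertex set. -/
theorem exists_tree_of_cluster_bound {G : SimpleGraph W} (hG : G.Preconnected) (r : W) (D : ℕ)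
    (hD : ∀ x y, clusterSetoid G r x y → G.dist x y ≤ D) :
    ∃ Y : SimpleGraph W, Y.IsAcyclic ∧ Y.Preconnected ∧
      ∀ x y, Y.dist x y ≤ 3 * G.dist x y ∧ G.dist x y ≤ (D + 1) * Y.dist x y := by
  have : Nonempty W := ⟨r⟩
  have hGc : G.Connected := ⟨hG⟩
  have one {s t : W} (h : G.Adj s t) : G.dist s t = 1 := SimpleGraph.dist_eq_one_iff_adj.2 h
  have hpred : ∀ x, ∃ y, x ≠ r → G.Adj x y ∧ G.dist r y + 1 = G.dist r x := by
    intro x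
    by_cases hx : x = r
    · exact ⟨x, fun h => absurd hx h⟩
    · have hpos := hGc.pos_dist_of_ne hx
      obtain ⟨y, hxy, hy⟩ := exists_adj_dist_eq hGc (x := x) (y := r)
        (m := G.dist x r - 1) (by omega)
      refine ⟨y, fun _ => ⟨hxy, ?_⟩⟩
      rw [G.dist_comm (u := r), G.dist_comm (u := r)]
      omega
  choose pred hpred using hpred
  let rep (x : W) : W := (Quotient.mk (clusterSetoid G r) x).out
  have hrep (x : W) : clusterSetoid G r (rep x) x := Quotient.mk_out (s := clusterSetoid G r) x
  have rep_eq {x y : W} (h : clusterSetoid G r x y) : rep x = rep y :=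
    congrArg Quotient.out (Quotient.sound (s := clusterSetoid G r) h)
  classical
  let par (x : W) : W := if x = r then r else rep (pred x)
  have par_of_ne {x : W} (h : x ≠ r) : par x = rep (pred x) := if_neg h
  have hlevel {x : W} (h : x ≠ r) : G.dist r (par x) + 1 = G.dist r x := by
    rw [par_of_ne h, (hrep (pred x)).1, (hpred x h).2]
  have eq_r {x : W} (h : G.dist r x = 0) : x = r := (hGc.dist_eq_zero_iff.1 h).symm
  have hpar {x y : W} (h : clusterSetoid G r x y) : par x = par y := by
    by_cases hx : x = r
    · subst hx
      rw [eq_r (h.1.symm.trans (by simp))]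
    by_cases hy : y = r
    · subst hy
      exact absurd (eq_r (h.1.trans (by simp))) hx
    obtain ⟨h, w, hw⟩ := h
    obtain ⟨hax, hlx⟩ := hpred x hx
    obtain ⟨hay, hly⟩ := hpred y hy
    rw [par_of_ne hx, par_of_ne hy]
    refine rep_eq ⟨by omega, .cons hax.symm (w.append hay.toWalk), fun z hz => ?_⟩
    simp only [SimpleGraph.Walk.support_cons, List.mem_cons,
      SimpleGraph.Walk.mem_support_append_iff, SimpleGraph.Walk.support_nil,
      List.not_mem_nil, or_false] at hz
    rcases hz with rfl | hz | rfl | rfl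
    · rfl
    · have := hw z hz
      omega
    · omega
    · omega
  have hYc : (parentGraph par).Preconnected :=
    parentGraph_preconnected par (G.dist r) r fun x hx => by have := hlevel hx; omega
  have hYpar (x : W) : (parentGraph par).dist x (par x) ≤ 1 := by
    by_cases h : par x = x
    · rw [h]; simp
    · exact (SimpleGraph.dist_eq_one_iff_adj.2
        ((SimpleGraph.fromRel_adj _ _ _).2 ⟨Ne.symm h, .inl rfl⟩)).le
  have triY (x y z : W) := (hYc x y).dist_triangle_left z
  have hYcluster {x y : W} (h : clusterSetoid G r x y) : (parentGraph par).dist x y ≤ 2 := by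
    have := triY x (par x) y
    have := hYpar x
    have := hYpar y
    have := (parentGraph par).dist_comm (u := par y) (v := y)
    rw [hpar h] at *
    omega
  have hup {x y : W} (hxy : G.Adj x y) (hl : G.dist r y = G.dist r x + 1) :
      (parentGraph par).dist x y ≤ 3 := by
    have hy : y ≠ r := by rintro rfl; simp at hl
    obtain ⟨hay, hly⟩ := hpred y hy
    have hc : clusterSetoid G r (pred y) x := by
      refine ⟨by omega, .cons hay.symm hxy.symm.toWalk, fun z hz => ?_⟩
      simp only [SimpleGraph.Walk.support_cons, List.mem_cons, SimpleGraph.Walk.support_nil,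
        List.not_mem_nil, or_false] at hz
      rcases hz with rfl | rfl | rfl <;> omega
    have hpy : par y = rep x := (par_of_ne hy).trans (rep_eq hc)
    have h1 := hYcluster (hrep x)
    have h2 := hYpar y
    rw [hpy] at h2
    have := triY x (rep x) y
    have := (parentGraph par).dist_comm (u := x) (v := rep x)
    have := (parentGraph par).dist_comm (u := y) (v := rep x)
    omega
  have hGpar (x : W) : G.dist x (par x) ≤ D + 1 := by
    by_cases hx : x = r
    · subst hx; simp [par]
    · rw [par_of_ne hx]
      have := hGc.dist_triangle (u := x) (v := pred x) (w := rep (pred x))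
      have := one (hpred x hx).1
      have := hD _ _ (hrep (pred x))
      have := G.dist_comm (u := pred x) (v := rep (pred x))
      omega
  refine ⟨parentGraph par, parentGraph_isAcyclic par (G.dist r) (fun x hx => ?_), hYc,
    fun x y => ⟨dist_le_mul_dist hG hYc (fun x y hxy => ?_) x y,
      dist_le_mul_dist hYc hG (fun x y hxy => ?_) x y⟩⟩
  · have hxr : x ≠ r := by
      rintro rfl
      exact hx (if_pos rfl)
    have := hlevel hxr
    omega
  · have h1 := hGc.dist_triangle (u := r) (v := x) (w := y)
    have h2 := hGc.dist_triangle (u := r) (v := y) (w := x)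
    have h3 := one hxy
    have h4 := one hxy.symm
    obtain h | h | h : G.dist r x = G.dist r y ∨ G.dist r y = G.dist r x + 1 ∨
      G.dist r x = G.dist r y + 1 := by omega
    · exact (hYcluster ⟨h, hxy.toWalk, by simp [h]⟩).trans (by omega)
    · exact hup hxy h
    · rw [SimpleGraph.dist_comm]
      exact hup hxy.symm h
  · obtain ⟨-, rfl | rfl⟩ := (SimpleGraph.fromRel_adj _ _ _).1 hxy
    · exact hGpar x
    · rw [SimpleGraph.dist_comm]
      exact hGpar y

end LayeringTree

/-- **Theorem A (Genevois–Valiunas).** For any quasi-median graph `X` there exist a simplicial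
tree `T` and a `(91,182)`-quasi-isometry from `T` to the contact graph `𝒞X`; in particular,
`𝒞X` is a quasi-tree. -/
theorem contactGraph_quasiTree {V : Type u} (X : SimpleGraph V) (hX : IsQuasiMedian X) :
    ∃ (T : Type u) (Y : SimpleGraph T), Y.IsAcyclic ∧ Y.Preconnected ∧
      ∃ f : T → Hyperplane X,
        IsQuasiIsometry 91 182 (fun a b => (Y.dist a b : ℝ))
          (fun H H' => ((contactGraph X).dist H H' : ℝ)) f := by
  rcases isEmpty_or_nonempty (Hyperplane X) with hempty | ⟨⟨R⟩⟩
  · exact ⟨Hyperplane X, ⊥, SimpleGraph.isAcyclic_bot, fun x => hempty.elim x, id,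
      fun x => hempty.elim x, fun x => hempty.elim x⟩
  obtain ⟨Y, hacyclic, hconn, hdist⟩ := exists_tree_of_cluster_bound
    (contactGraph_preconnected hX.connected) R 8
    fun A B ⟨hAB, W, hW⟩ => hX.dist_le_of_walk R hAB W hW
  refine ⟨Hyperplane X, Y, hacyclic, hconn, id, fun A B => ?_, fun A => ⟨A, by simp⟩⟩
  obtain ⟨h₁, h₂⟩ := hdist A B
  have h₁' : (Y.dist A B : ℝ) ≤ 3 * (contactGraph X).dist A B := by exact_mod_cast h₁
  have h₂' : ((contactGraph X).dist A B : ℝ) ≤ 9 * Y.dist A B := by exact_mod_cast h₂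
  have h₃ : (0 : ℝ) ≤ Y.dist A B := Nat.cast_nonneg _
  have h₄ : (0 : ℝ) ≤ (contactGraph X).dist A B := Nat.cast_nonneg _
  simp only [id]
  constructor <;> linarith

end QM
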